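/- arXiv:2603.23790 — 3 statements merged into one kernel-verified Lean document; each statement's English description precedes it below -/
import Mathlib

section
/- Let Θ ⊆ ℝ^d and let m, δ, V : Θ → ℝ with δ ≥ 0 and V ≥ 0 on Θ. Define f(θ) := m(θ)² and f̄(θ) := m(θ)² + δ(θ) + V(θ). Assume: (i) θ̄* ∈ Θ satisfies f̄(θ) − f̄(θ̄*) ≥ (ℓ_C/2)‖θ − θ̄*‖² for all θ ∈ Θ with ℓ_C > 0; (ii) Θ* := {θ ∈ Θ : m(θ) = 0} is nonempty; (iii) m is ℓ_E-Lipschitz, δ is ℓ_δ-Lipschitz, and V is ℓ_V-Lipschitz on Θ; (iv) sup_{θ∈Θ*}(δ(θ) + V(θ)) < ∞. Then for every θ_n ∈ Θ for which a nearest point of Θ* to θ_n exists, writing d := dist(θ_n, Θ*), one has ‖θ_n − θ̄*‖² ≤ (2/ℓ_C)(ℓ_E² d² + sup_{θ∈Θ*}(δ(θ) + V(θ)) + (ℓ_δ + ℓ_V) d). -/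
open Metric

/-- deterministic solution accuracy bound.  With `f = m²`,
`f̄ = m² + δ + V`, `θ̄*` a strongly-convex minimizer of `f̄`, `Θ*` the root set of
`m`, and `m, δ, V` Lipschitz on `Θ`, one has for every `θ_n ∈ Θ` admitting a
nearest point of `Θ*`,
`‖θ_n − θ̄*‖² ≤ (2/ℓ_C)(ℓ_E² d² + sup_{Θ*}(δ + V) + (ℓ_δ + ℓ_V) d)` with
`d = dist(θ_n, Θ*)`. -/
theorem solution_accuracy_bound
    {d : ℕ} (Θ : Set (EuclideanSpace ℝ (Fin d)))
    (mfun δfun Vfun : EuclideanSpace ℝ (Fin d) → ℝ)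
    (hδpos : ∀ θ ∈ Θ, 0 ≤ δfun θ) (hVpos : ∀ θ ∈ Θ, 0 ≤ Vfun θ)
    (f fbar : EuclideanSpace ℝ (Fin d) → ℝ)
    (hf : ∀ θ, f θ = (mfun θ) ^ 2)
    (hfbar : ∀ θ, fbar θ = (mfun θ) ^ 2 + δfun θ + Vfun θ)
    (ℓC : ℝ) (hℓC : 0 < ℓC)
    (θbar : EuclideanSpace ℝ (Fin d)) (hθbar : θbar ∈ Θ)
    (hgrowth : ∀ θ ∈ Θ, ℓC / 2 * ‖θ - θbar‖ ^ 2 ≤ fbar θ - fbar θbar)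
    (Θstar : Set (EuclideanSpace ℝ (Fin d)))
    (hΘstar : Θstar = {θ ∈ Θ | mfun θ = 0}) (hne : Θstar.Nonempty)
    (ℓE ℓδ ℓV : ℝ)
    (hmLip : ∀ a ∈ Θ, ∀ b ∈ Θ, |mfun a - mfun b| ≤ ℓE * ‖a - b‖)
    (hδLip : ∀ a ∈ Θ, ∀ b ∈ Θ, |δfun a - δfun b| ≤ ℓδ * ‖a - b‖)
    (hVLip : ∀ a ∈ Θ, ∀ b ∈ Θ, |Vfun a - Vfun b| ≤ ℓV * ‖a - b‖)
    (hbdd : BddAbove ((fun θ => δfun θ + Vfun θ) '' Θstar)) :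
    ∀ θn ∈ Θ, (∃ θb ∈ Θstar, ∀ θ ∈ Θstar, ‖θn - θb‖ ≤ ‖θn - θ‖) →
      ‖θn - θbar‖ ^ 2
        ≤ (2 / ℓC) * (ℓE ^ 2 * (infDist θn Θstar) ^ 2
            + sSup ((fun θ => δfun θ + Vfun θ) '' Θstar)
            + (ℓδ + ℓV) * infDist θn Θstar) := by
  subst hΘstar
  rintro θn hθn ⟨θb, hb, hmin⟩
  have hdist : infDist θn {θ ∈ Θ | mfun θ = 0} = ‖θn - θb‖ := by
    refine le_antisymm ((infDist_le_dist_of_mem hb).trans_eq (dist_eq_norm _ _)) ?_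
    exact (le_infDist hne).2 fun {θ} hθ => (hmin θ hθ).trans_eq (dist_eq_norm _ _).symm
  rw [hdist]
  have hsup : δfun θb + Vfun θb ≤
      sSup ((fun θ => δfun θ + Vfun θ) '' {θ ∈ Θ | mfun θ = 0}) :=
    le_csSup hbdd (Set.mem_image_of_mem _ hb)
  have hm : mfun θn ^ 2 ≤ ℓE ^ 2 * ‖θn - θb‖ ^ 2 := by
    have h := hmLip θn hθn θb hb.1
    rw [hb.2, sub_zero] at h
    rw [← mul_pow, ← sq_abs (mfun θn)]
    gcongr
  have hδ := (le_abs_self _).trans (hδLip θn hθn θb hb.1)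
  have hV := (le_abs_self _).trans (hVLip θn hθn θb hb.1)
  have hg := hgrowth θn hθn
  rw [hfbar, hfbar] at hg
  rw [div_mul_eq_mul_div, le_div_iff₀ hℓC]
  linarith [hδpos θbar hθbar, hVpos θbar hθbar, sq_nonneg (mfun θbar)]
end

section
/- Let Θ ⊆ ℝ^d and let m, δ, V : Θ → ℝ with δ ≥ 0 and V ≥ 0 on Θ. Define f(θ) := m(θ)² and f̄(θ) := m(θ)² + δ(θ) + V(θ). Assume: (i) θ̄* ∈ Θ satisfies f̄(θ) − f̄(θ̄*) ≥ (ℓ_C/2)‖θ − θ̄*‖² for all θ ∈ Θ with ℓ_C > 0; (ii) Θ* := {θ ∈ Θ : m(θ) = 0} is nonempty; (iii) m is ℓ_E-Lipschitz, δ is ℓ_δ-Lipschitz, V is ℓ_V-Lipschitz on Θ; (iv) sup_{θ∈Θ*}(δ(θ) + V(θ)) < ∞. Let θ̂ : Ω → Θ be a random element on a probability space such that D := dist(θ̂, Θ*) satisfies E[D²] < ∞ and such that a nearest point of Θ* to θ̂(ω) exists for almost every ω. Then E[‖θ̂ − θ̄*‖²] ≤ (2/ℓ_C)(2ℓ_E²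 E[D²] + sup_{θ∈Θ*}(δ(θ) + V(θ)) + (ℓ_δ + ℓ_V)(E[D²])^{1/2}). -/
open MeasureTheory Metric

/-- On a probability space the mean of a random variable is at most its root mean square. -/
lemma integral_le_sqrt_integral_sq {Ω : Type*} [MeasurableSpace Ω] {μ : Measure Ω}
    [IsProbabilityMeasure μ] {X : Ω → ℝ} (hX : MemLp X 2 μ) :
    ∫ ω, X ω ∂μ ≤ Real.sqrt (∫ ω, X ω ^ 2 ∂μ) := by
  apply Real.le_sqrt_of_sq_le
  have h := ProbabilityTheory.variance_nonneg X μ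
  rw [ProbabilityTheory.variance_eq_sub hX] at h
  simpa using h

/-- expected solution accuracy bound.  Under the same structural
assumptions as the deterministic bound, for a random element `θ̂` of `Θ` with
`D := dist(θ̂, Θ*)` square-integrable and admitting an a.e. nearest point in `Θ*`,
`E[‖θ̂ − θ̄*‖²] ≤ (2/ℓ_C)(2ℓ_E² E[D²] + sup_{Θ*}(δ + V) + (ℓ_δ + ℓ_V)(E[D²])^{1/2})`. -/
theorem expected_solution_accuracy_bound
    {Ω : Type*} [MeasureSpace Ω] [IsProbabilityMeasure (volume : Measure Ω)]
    {d : ℕ} (Θ : Set (EuclideanSpace ℝ (Fin d)))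
    (mfun δfun Vfun : EuclideanSpace ℝ (Fin d) → ℝ)
    (hδpos : ∀ θ ∈ Θ, 0 ≤ δfun θ) (hVpos : ∀ θ ∈ Θ, 0 ≤ Vfun θ)
    (f fbar : EuclideanSpace ℝ (Fin d) → ℝ)
    (hf : ∀ θ, f θ = (mfun θ) ^ 2)
    (hfbar : ∀ θ, fbar θ = (mfun θ) ^ 2 + δfun θ + Vfun θ)
    (ℓC : ℝ) (hℓC : 0 < ℓC)
    (θbar : EuclideanSpace ℝ (Fin d)) (hθbar : θbar ∈ Θ)
    (hgrowth : ∀ θ ∈ Θ, ℓC / 2 * ‖θ - θbar‖ ^ 2 ≤ fbar θ - fbar θbar)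
    (Θstar : Set (EuclideanSpace ℝ (Fin d)))
    (hΘstar : Θstar = {θ ∈ Θ | mfun θ = 0}) (hne : Θstar.Nonempty)
    (ℓE ℓδ ℓV : ℝ)
    (hmLip : ∀ a ∈ Θ, ∀ b ∈ Θ, |mfun a - mfun b| ≤ ℓE * ‖a - b‖)
    (hδLip : ∀ a ∈ Θ, ∀ b ∈ Θ, |δfun a - δfun b| ≤ ℓδ * ‖a - b‖)
    (hVLip : ∀ a ∈ Θ, ∀ b ∈ Θ, |Vfun a - Vfun b| ≤ ℓV * ‖a - b‖)
    (hbdd : BddAbove ((fun θ => δfun θ + Vfun θ) '' Θstar))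
    (θhat : Ω → EuclideanSpace ℝ (Fin d)) (hθhatmeas : Measurable θhat)
    (hθhatΘ : ∀ ω, θhat ω ∈ Θ)
    (hD2 : Integrable (fun ω => (infDist (θhat ω) Θstar) ^ 2))
    (hnear : ∀ᵐ ω ∂(volume : Measure Ω),
      ∃ θb ∈ Θstar, ∀ θ ∈ Θstar, ‖θhat ω - θb‖ ≤ ‖θhat ω - θ‖) :
    (∫ ω, ‖θhat ω - θbar‖ ^ 2)
      ≤ (2 / ℓC) * (2 * ℓE ^ 2 * (∫ ω, (infDist (θhat ω) Θstar) ^ 2)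
          + sSup ((fun θ => δfun θ + Vfun θ) '' Θstar)
          + (ℓδ + ℓV) * Real.sqrt (∫ ω, (infDist (θhat ω) Θstar) ^ 2)) := by
  set D : Ω → ℝ := fun ω => infDist (θhat ω) Θstar with hD
  set S : ℝ := sSup ((fun θ => δfun θ + Vfun θ) '' Θstar) with hS
  have hDmeas : Measurable D := (continuous_infDist_pt Θstar).measurable.comp hθhatmeas
  have hDL2 : MemLp D 2 := (memLp_two_iff_integrable_sq hDmeas.aestronglyMeasurable).2 hD2
  have hDint : Integrable D := hDL2.integrable one_le_two
  have hpt : ∀ᵐ ω ∂(volume : Measure Ω), ‖θhat ω - θbar‖ ^ 2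
      ≤ (2 / ℓC) * (2 * ℓE ^ 2 * D ω ^ 2 + S + (ℓδ + ℓV) * D ω) := by
    filter_upwards [hnear] with ω ⟨θb, hb, hmin⟩
    have hDeq : D ω = ‖θhat ω - θb‖ := by
      apply le_antisymm
      · rw [← dist_eq_norm]
        exact infDist_le_dist_of_mem hb
      · refine (le_infDist hne).2 fun θ hθ => ?_
        rw [dist_eq_norm]
        exact hmin θ hθ
    have hb' : θb ∈ Θ ∧ mfun θb = 0 := by
      rw [hΘstar] at hb
      exact hb
    have hSb : δfun θb + Vfun θb ≤ S := le_csSup hbdd ⟨θb, hb, rfl⟩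
    have hm := hmLip _ (hθhatΘ ω) _ hb'.1
    have hδ := (abs_le.1 (hδLip _ (hθhatΘ ω) _ hb'.1)).2
    have hV := (abs_le.1 (hVLip _ (hθhatΘ ω) _ hb'.1)).2
    rw [← hDeq] at hm hδ hV
    rw [hb'.2, sub_zero] at hm
    have hm2 : mfun (θhat ω) ^ 2 ≤ ℓE ^ 2 * D ω ^ 2 := by
      rw [← mul_pow]
      exact sq_le_sq.2 (hm.trans (le_abs_self _))
    have hg := hgrowth _ (hθhatΘ ω)
    rw [hfbar, hfbar] at hg
    have hδ0 := hδpos _ hθbar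
    have hV0 := hVpos _ hθbar
    have hsq : 0 ≤ ℓE ^ 2 * D ω ^ 2 := by positivity
    have hkey : ℓC / 2 * ‖θhat ω - θbar‖ ^ 2
        ≤ 2 * ℓE ^ 2 * D ω ^ 2 + S + (ℓδ + ℓV) * D ω := by
      nlinarith [sq_nonneg (mfun θbar)]
    calc ‖θhat ω - θbar‖ ^ 2 = (2 / ℓC) * (ℓC / 2 * ‖θhat ω - θbar‖ ^ 2) := by field_simp
      _ ≤ _ := by gcongr
  have hint₁ : Integrable (fun ω => 2 * ℓE ^ 2 * D ω ^ 2) := hD2.const_mul _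
  have hint₂ : Integrable (fun ω => 2 * ℓE ^ 2 * D ω ^ 2 + S) := hint₁.add (integrable_const S)
  have hint₃ : Integrable (fun ω => (ℓδ + ℓV) * D ω) := hDint.const_mul _
  have hE : ∫ ω, ‖θhat ω - θbar‖ ^ 2
      ≤ (2 / ℓC) * (2 * ℓE ^ 2 * (∫ ω, D ω ^ 2) + S + (ℓδ + ℓV) * ∫ ω, D ω) := by
    refine (integral_mono_of_nonneg (Filter.Eventually.of_forall fun ω => by positivity)
      ((hint₂.add hint₃).const_mul (2 / ℓC)) hpt).trans_eq ?_
    simp only [Pi.add_apply]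
    rw [integral_const_mul, integral_add hint₂ hint₃, integral_add hint₁ (integrable_const S),
      integral_const_mul, integral_const_mul]
    simp
  have hlin : (ℓδ + ℓV) * ∫ ω, D ω ≤ (ℓδ + ℓV) * Real.sqrt (∫ ω, D ω ^ 2) := by
    rcases le_or_gt 0 (ℓδ + ℓV) with hℓ | hℓ
    · exact mul_le_mul_of_nonneg_left (integral_le_sqrt_integral_sq hDL2) hℓ
    -- A negative Lipschitz constant forces `Θ` to be a single point.
    · have hsub : ∀ a ∈ Θ, ∀ b ∈ Θ, a = b := by
        intro a ha b hb
        have h₁ := (abs_nonneg _).trans (hδLip a ha b hb)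
        have h₂ := (abs_nonneg _).trans (hVLip a ha b hb)
        have h₃ := norm_nonneg (a - b)
        exact sub_eq_zero.1 (norm_eq_zero.1 (by nlinarith))
      have hD0 : D = fun _ => 0 := by
        funext ω
        obtain ⟨θ, hθ⟩ := hne
        have hθΘ : θ ∈ Θ := by
          rw [hΘstar] at hθ
          exact hθ.1
        apply infDist_zero_of_mem
        rwa [hsub _ (hθhatΘ ω) _ hθΘ]
      simp [hD0]
  refine hE.trans ?_
  gcongr
end

section
/- Let Z be a standard normal random variable, let μ, v ∈ ℝ and σ > 0, and set z := (v − μ)/σ. Then E[max(0, v − (μ + σZ))] = (v − μ)·Φ(z) + σ·φ(z), where Φ and φ are the standard normal cumulative distribution function and density. -/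
open MeasureTheory ProbabilityTheory

/-- The standard normal density `φ(b) = (2π)^{-1/2} e^{-b²/2}`. -/
noncomputable def stdGaussianPDF (b : ℝ) : ℝ :=
  (Real.sqrt (2 * Real.pi))⁻¹ * Real.exp (-(b ^ 2) / 2)

/-- The standard normal cumulative distribution function `Φ(a) = ∫_{-∞}^a φ`. -/
noncomputable def stdGaussianCDF (a : ℝ) : ℝ :=
  ∫ b in Set.Iic a, stdGaussianPDF b

lemma gaussianPDFReal_zero_one (b : ℝ) : gaussianPDFReal 0 1 b = stdGaussianPDF b := by
  simp [gaussianPDFReal, stdGaussianPDF]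

lemma integrable_stdGaussianPDF : Integrable stdGaussianPDF :=
  (integrable_gaussianPDFReal 0 1).congr (.of_forall gaussianPDFReal_zero_one)

lemma integrable_neg_mul_stdGaussianPDF : Integrable fun b ↦ -b * stdGaussianPDF b := by
  refine ((integrable_mul_exp_neg_mul_sq (b := 1 / 2) (by norm_num)).const_mul
    (-(Real.sqrt (2 * Real.pi))⁻¹)).congr (.of_forall fun b ↦ ?_)
  simp only [stdGaussianPDF]
  rw [show -(1 / 2 : ℝ) * b ^ 2 = -(b ^ 2) / 2 by ring]
  ring

lemma hasDerivAt_stdGaussianPDF (b : ℝ) :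
    HasDerivAt stdGaussianPDF (-b * stdGaussianPDF b) b := by
  have h : HasDerivAt (fun x : ℝ ↦ -(x ^ 2) / 2) (-b) b :=
    (((hasDerivAt_pow 2 b).neg).div_const 2).congr_deriv (by norm_num; ring)
  refine (h.exp.const_mul (Real.sqrt (2 * Real.pi))⁻¹).congr_deriv ?_
  simp only [stdGaussianPDF]
  ring

lemma setIntegral_Iic_neg_mul_stdGaussianPDF (a : ℝ) :
    ∫ b in Set.Iic a, -b * stdGaussianPDF b = stdGaussianPDF a := by
  have hd : ∀ x ∈ Set.Iic a, HasDerivAt stdGaussianPDF (-x * stdGaussianPDF x) x :=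
    fun x _ ↦ hasDerivAt_stdGaussianPDF x
  have hi := integrable_neg_mul_stdGaussianPDF.integrableOn (s := Set.Iic a)
  rw [integral_Iic_of_hasDerivAt_of_tendsto' hd hi
    (tendsto_zero_of_hasDerivAt_of_integrableOn_Iic hd hi
      integrable_stdGaussianPDF.integrableOn), sub_zero]

/-- closed form of the Expected Improvement acquisition:
for `Z` standard normal, `σ > 0`, and `z = (v − μ)/σ`,
`E[max(0, v − (μ + σZ))] = (v − μ)Φ(z) + σφ(z)`. -/
theorem expected_improvement_closed_form
    {Ω : Type*} [MeasureSpace Ω] [IsProbabilityMeasure (volume : Measure Ω)]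
    (Z : Ω → ℝ) (hZ : Measure.map Z volume = gaussianReal 0 1)
    (μ v σ : ℝ) (hσ : 0 < σ) (z : ℝ) (hz : z = (v - μ) / σ) :
    (∫ ω, max 0 (v - (μ + σ * Z ω)))
      = (v - μ) * stdGaussianCDF z + σ * stdGaussianPDF z := by
  have hZm : AEMeasurable Z volume :=
    AEMeasurable.of_map_ne_zero (hZ ▸ IsProbabilityMeasure.ne_zero (gaussianReal 0 1))
  have hvμ : v - μ = σ * z := by rw [hz]; field_simp
  have hpt (x : ℝ) : gaussianPDFReal 0 1 x • max 0 (v - (μ + σ * x)) =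
      (Set.Iic z).indicator
        (fun b ↦ (v - μ) * stdGaussianPDF b + σ * (-b * stdGaussianPDF b)) x := by
    rw [gaussianPDFReal_zero_one, smul_eq_mul,
      show v - (μ + σ * x) = σ * (z - x) by linear_combination hvμ]
    by_cases hx : x ≤ z
    · rw [Set.indicator_of_mem (Set.mem_Iic.2 hx),
        max_eq_right (mul_nonneg hσ.le (sub_nonneg.2 hx)), hvμ]
      ring
    · rw [Set.indicator_of_notMem (by simpa using hx), max_eq_left, mul_zero]
      exact mul_nonpos_of_nonneg_of_nonpos hσ.le (by linarith)
  rw [← integral_map (f := fun x ↦ max 0 (v - (μ + σ * x))) hZm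
      (by fun_prop), hZ, integral_gaussianReal_eq_integral_smul one_ne_zero]
  simp_rw [hpt]
  rw [integral_indicator measurableSet_Iic,
    integral_add (integrable_stdGaussianPDF.integrableOn.const_mul _)
      (integrable_neg_mul_stdGaussianPDF.integrableOn.const_mul _),
    integral_const_mul, integral_const_mul, setIntegral_Iic_neg_mul_stdGaussianPDF,
    stdGaussianCDF]
end
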